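/- Let A : Diff_id^1(ℝ³) → 𝓛(V,V*) assign to each φ a bounded symmetric nonnegative operator A_φ, let ω > 0, and for j ∈ V* and φ ∈ Diff_id^1(ℝ³) set v_{φ,j} = (ω K_V⁻¹ + A_φ)⁻¹ j and F(j,φ) = v_{φ,j} ∘ φ. Then for all j ∈ V* and all φ, ψ ∈ Diff_id^1(ℝ³): ‖F(j,φ) − F(j,ψ)‖_{1,∞} ≤ (2 + ‖ψ − id‖_{1,∞}) · ( (c_V/ω) ‖φ − ψ‖_{1,∞} + (c_V/ω²) ‖A_φ − A_ψ‖_{𝓛(V,V*)} ) · ‖j‖_{V*}. In particular, if φ ↦ A_φ is locally Lipschitz for ‖·‖_{1,∞}, then φ ↦ F(j,φ) is locally Lipschitz. -/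

import Mathlib

open MeasureTheory Filter Set
open scoped RealInnerProductSpace Topology

noncomputable section

/-- Euclidean 3-space. -/
abbrev E3 : Type := EuclideanSpace ℝ (Fin 3)

/-- The supremum over `ℝ³` of the norm of the `k`-th derivative of `v`. -/
def supDeriv (k : ℕ) (v : E3 → E3) : ℝ := ⨆ x : E3, ‖iteratedFDeriv ℝ k v x‖

/-- The norm `‖v‖_{s,∞} = Σ_{k ≤ s} sup_x |Dᵏ v(x)|`. -/
def normS (s : ℕ) (v : E3 → E3) : ℝ := ∑ k ∈ Finset.range (s + 1), supDeriv k v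

/-- The seminorm `‖v‖_{1,∞}^Ω = sup_{x ∈ Ω} |v(x)| + sup_{x ∈ Ω} |Dv(x)|`. -/
def normSOn (Ω : Set E3) (v : E3 → E3) : ℝ :=
  (⨆ x : Ω, ‖v (x : E3)‖) + ⨆ x : Ω, ‖fderiv ℝ v (x : E3)‖

/-- Membership in `C₀^s(ℝ³,ℝ³)`: `v` is `C^s` and all derivatives up to order `s`
tend to `0` at infinity. -/
def MemC0 (s : ℕ) (v : E3 → E3) : Prop :=
  ContDiff ℝ s v ∧
    ∀ k ≤ s, Tendsto (fun x => ‖iteratedFDeriv ℝ k v x‖) (cocompact E3) (𝓝 0)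

/-- `Diff_id^s(ℝ³)`: `C^s`-diffeomorphisms of `ℝ³` equal to the identity at infinity. -/
structure DiffId (s : ℕ) : Type where
  toFun : E3 → E3
  invFun : E3 → E3
  left_inv : Function.LeftInverse invFun toFun
  right_inv : Function.RightInverse invFun toFun
  memC0 : MemC0 s fun x => toFun x - x
  memC0_inv : MemC0 s fun x => invFun x - x

instance (s : ℕ) : CoeFun (DiffId s) fun _ => E3 → E3 := ⟨DiffId.toFun⟩

/-- The distance `‖φ − ψ‖_{s,∞}` on `Diff_id^s(ℝ³)`. -/
def distS (s : ℕ) (φ ψ : DiffId s) : ℝ := normS s fun x => φ x - ψ x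

/-- The set `𝔖_γ = {φ : ‖φ − id‖_{1,∞} ≤ γ and ‖φ⁻¹ − id‖_{1,∞} ≤ γ}`. -/
def Sgamma (γ : ℝ) : Set (DiffId 1) :=
  {φ | normS 1 (fun x => φ x - x) ≤ γ ∧ normS 1 (fun x => φ.invFun x - x) ≤ γ}

/-- `v` is the velocity `(ω K_V⁻¹ + B)⁻¹ j`, i.e. the unique minimizer of
`(ω/2)‖·‖² + (1/2)(B · | ·) − (j | ·)`:  `ω⟪v,w⟫ + (Bv|w) = (j|w)` for all `w`. -/
def IsVel {V : Type*} [NormedAddCommGroup V] [InnerProductSpace ℝ V]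
    (B : V →L[ℝ] V →L[ℝ] ℝ) (ω : ℝ) (j : V →L[ℝ] ℝ) (v : V) : Prop :=
  ∀ w : V, ω * ⟪v, w⟫ + B v w = j w

/-- `(φ, v)` solves the control system
`φ(t) = id + ∫₀ᵗ v(s) ∘ φ(s) ds`, `v(s) = (ω K_V⁻¹ + A_{φ(s)})⁻¹ j(s)` on `[0,T₀]`,
with `t ↦ φ(t)` continuous into `Diff_id¹(ℝ³)`. -/
def IsSolution {V : Type*} [NormedAddCommGroup V] [InnerProductSpace ℝ V]
    (emb : V →ₗ[ℝ] (E3 → E3)) (ω : ℝ) (A : DiffId 1 → V →L[ℝ] V →L[ℝ] ℝ)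
    (j : ℝ → V →L[ℝ] ℝ) (T₀ : ℝ) (φ : ℝ → DiffId 1) (v : ℝ → V) : Prop :=
  (∀ t ∈ Icc (0 : ℝ) T₀, IsVel (A (φ t)) ω (j t) (v t)) ∧
  (∀ t ∈ Icc (0 : ℝ) T₀, ∀ x : E3,
    IntervalIntegrable (fun s => emb (v s) (φ s x)) volume 0 t ∧
      φ t x = x + ∫ s in (0 : ℝ)..t, emb (v s) (φ s x)) ∧
  ∀ t₀ ∈ Icc (0 : ℝ) T₀,
    Tendsto (fun t => distS 1 (φ t) (φ t₀)) (𝓝[Icc (0 : ℝ) T₀] t₀) (𝓝 0)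


lemma aux_bdd {s : ℕ} {v : E3 → E3} (h : MemC0 s v) {k : ℕ} (hk : k ≤ s) :
    BddAbove (range fun x : E3 => ‖iteratedFDeriv ℝ k v x‖) := by
  have hc : Continuous fun x : E3 => ‖iteratedFDeriv ℝ k v x‖ :=
    (h.1.continuous_iteratedFDeriv (by exact_mod_cast hk)).norm
  have h1 : ∀ᶠ x in cocompact E3, ‖iteratedFDeriv ℝ k v x‖ < 1 :=
    (h.2 k hk).eventually (gt_mem_nhds one_pos)
  obtain ⟨K, hK, hK1⟩ := mem_cocompact.1 h1
  obtain ⟨C, hC⟩ := hK.bddAbove_image hc.continuousOn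
  refine ⟨max C 1, ?_⟩
  rintro _ ⟨x, rfl⟩
  by_cases hx : x ∈ K
  · exact le_max_of_le_left (hC (mem_image_of_mem _ hx))
  · exact le_max_of_le_right (le_of_lt (hK1 hx))

lemma aux_le {s : ℕ} {v : E3 → E3} (h : MemC0 s v) {k : ℕ} (hk : k ≤ s) (x : E3) :
    ‖iteratedFDeriv ℝ k v x‖ ≤ supDeriv k v :=
  le_ciSup (aux_bdd h hk) x

lemma aux_nonneg (k : ℕ) (v : E3 → E3) : 0 ≤ supDeriv k v :=
  Real.iSup_nonneg fun _ => norm_nonneg _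

lemma aux_normS_nonneg (s : ℕ) (v : E3 → E3) : 0 ≤ normS s v :=
  Finset.sum_nonneg fun k _ => aux_nonneg k v

lemma aux_normS1 (v : E3 → E3) : normS 1 v = supDeriv 0 v + supDeriv 1 v := by
  simp [normS, Finset.sum_range_succ]

lemma aux_normS2 (v : E3 → E3) :
    normS 2 v = supDeriv 0 v + supDeriv 1 v + supDeriv 2 v := by
  simp [normS, Finset.sum_range_succ]

lemma aux_iter_sub {s : ℕ} {u v : E3 → E3} (hu : ContDiff ℝ s u) (hv : ContDiff ℝ s v)
    {k : ℕ} (hk : k ≤ s) (x : E3) :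
    ‖iteratedFDeriv ℝ k (fun x => u x - v x) x‖ ≤
      ‖iteratedFDeriv ℝ k u x‖ + ‖iteratedFDeriv ℝ k v x‖ := by
  have hk' : (k : WithTop ℕ∞) ≤ s := by exact_mod_cast hk
  have := iteratedFDeriv_sub_apply (𝕜 := ℝ) (i := k) (x := x)
    (hu.of_le hk').contDiffAt (hv.of_le hk').contDiffAt
  have e : (fun x => u x - v x) = u - v := rfl
  rw [e, this]
  exact norm_sub_le _ _

lemma aux_sub {s : ℕ} {u v : E3 → E3} (hu : MemC0 s u) (hv : MemC0 s v) :
    MemC0 s (fun x => u x - v x) := by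
  refine ⟨hu.1.sub hv.1, fun k hk => ?_⟩
  refine squeeze_zero (fun _ => norm_nonneg _) (aux_iter_sub hu.1 hv.1 hk) ?_
  simpa using (hu.2 k hk).add (hv.2 k hk)

lemma aux_tri {s : ℕ} {u v : E3 → E3} (hu : MemC0 s u) (hv : MemC0 s v) :
    normS s (fun x => u x - v x) ≤ normS s u + normS s v := by
  unfold normS
  rw [← Finset.sum_add_distrib]
  refine Finset.sum_le_sum fun k hk => ?_
  have hk : k ≤ s := by simpa [Nat.lt_succ_iff] using hk
  exact ciSup_le fun x => (aux_iter_sub hu.1 hv.1 hk x).trans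
    (add_le_add (aux_le hu hk x) (aux_le hv hk x))

lemma aux_diff (φ ψ : DiffId 1) : MemC0 1 (fun x => φ x - ψ x) := by
  have := aux_sub φ.memC0 ψ.memC0
  simpa using this

lemma aux_differentiable (φ : DiffId 1) : Differentiable ℝ φ.toFun := by
  have h : Differentiable ℝ (fun x => φ.toFun x - x) := φ.memC0.1.differentiable (by simp)
  have h2 := h.add differentiable_id
  have e : φ.toFun = (fun x => φ.toFun x - x) + id := by
    funext x
    simp
  rw [e]
  exact h2

lemma aux_comp {f g : E3 → E3} (hf : MemC0 2 f) (hg : MemC0 2 g) (φ ψ : DiffId 1)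
    {a b : ℝ} (ha : normS 2 f ≤ a) (hb : normS 2 (fun x => f x - g x) ≤ b) :
    normS 1 (fun x => f (φ x) - g (ψ x)) ≤
      (2 + normS 1 fun x => ψ x - x) * (a * distS 1 φ ψ + b) := by
  have hh := aux_sub hf hg
  have hd := aux_diff φ ψ
  have hφ := aux_differentiable φ
  have hψ := aux_differentiable ψ
  have fd : Differentiable ℝ f := hf.1.differentiable (by simp)
  have gd : Differentiable ℝ g := hg.1.differentiable (by simp)
  have f'd : Differentiable ℝ (fderiv ℝ f) :=
    (hf.1.fderiv_right (m := 1) (by norm_num)).differentiable (by simp)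
  have f1 : ∀ x, ‖fderiv ℝ f x‖ ≤ supDeriv 1 f := fun x => by
    rw [← norm_iteratedFDeriv_one]; exact aux_le hf (by norm_num) x
  have f2 : ∀ x, ‖fderiv ℝ (fderiv ℝ f) x‖ ≤ supDeriv 2 f := fun x => by
    rw [← norm_iteratedFDeriv_one, norm_iteratedFDeriv_fderiv]
    exact aux_le hf (by norm_num) x
  have h0 : ∀ x, ‖f x - g x‖ ≤ supDeriv 0 (fun x => f x - g x) := fun x => by
    rw [← norm_iteratedFDeriv_zero (𝕜 := ℝ) (f := fun x => f x - g x)]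
    exact aux_le hh (by norm_num) x
  have h1 : ∀ x, ‖fderiv ℝ f x - fderiv ℝ g x‖ ≤ supDeriv 1 (fun x => f x - g x) := fun x => by
    have := aux_le hh (k := 1) (by norm_num) x
    rwa [norm_iteratedFDeriv_one, fderiv_fun_sub (fd x) (gd x)] at this
  have d0 : ∀ x, ‖φ x - ψ x‖ ≤ supDeriv 0 (fun x => φ x - ψ x) := fun x => by
    rw [← norm_iteratedFDeriv_zero (𝕜 := ℝ) (f := fun x => φ x - ψ x)]
    exact aux_le hd (by norm_num) x
  have d1 : ∀ x, ‖fderiv ℝ φ.toFun x - fderiv ℝ ψ.toFun x‖ ≤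
      supDeriv 1 (fun x => φ x - ψ x) := fun x => by
    have := aux_le hd (k := 1) (by norm_num) x
    rwa [norm_iteratedFDeriv_one, fderiv_fun_sub (hφ x) (hψ x)] at this
  have n1 : ∀ x, ‖fderiv ℝ ψ.toFun x‖ ≤ 1 + supDeriv 1 (fun x => ψ x - x) := fun x => by
    have := aux_le ψ.memC0 (k := 1) (by norm_num) x
    rw [norm_iteratedFDeriv_one, fderiv_fun_sub (hψ x) differentiableAt_fun_id, fderiv_fun_id] at this
    have h2 : ‖ContinuousLinearMap.id ℝ E3‖ ≤ 1 := ContinuousLinearMap.norm_id_le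
    have h3 := norm_le_norm_add_norm_sub' (fderiv ℝ ψ.toFun x) (ContinuousLinearMap.id ℝ E3)
    linarith
  have lip0 : ∀ x y, ‖f x - f y‖ ≤ supDeriv 1 f * ‖x - y‖ := fun x y =>
    convex_univ.norm_image_sub_le_of_norm_fderiv_le (𝕜 := ℝ) (fun z _ => fd z)
      (fun z _ => f1 z) (mem_univ y) (mem_univ x)
  have lip1 : ∀ x y, ‖fderiv ℝ f x - fderiv ℝ f y‖ ≤ supDeriv 2 f * ‖x - y‖ := fun x y =>
    convex_univ.norm_image_sub_le_of_norm_fderiv_le (𝕜 := ℝ) (fun z _ => f'd z)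
      (fun z _ => f2 z) (mem_univ y) (mem_univ x)
  rw [aux_normS2] at ha hb
  unfold distS
  rw [aux_normS1, aux_normS1, aux_normS1]
  have p0 := aux_nonneg 0 f
  have p1 := aux_nonneg 1 f
  have p2 := aux_nonneg 2 f
  have q0 := aux_nonneg 0 (fun x => f x - g x)
  have q1 := aux_nonneg 1 (fun x => f x - g x)
  have q2 := aux_nonneg 2 (fun x => f x - g x)
  have r0 := aux_nonneg 0 (fun x => φ x - ψ x)
  have r1 := aux_nonneg 1 (fun x => φ x - ψ x)
  have t0 := aux_nonneg 0 (fun x => ψ x - x)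
  have t1 := aux_nonneg 1 (fun x => ψ x - x)
  have e0 : supDeriv 0 (fun x => f (φ x) - g (ψ x)) ≤
      supDeriv 1 f * supDeriv 0 (fun x => φ x - ψ x) + supDeriv 0 (fun x => f x - g x) := by
    refine ciSup_le fun x => ?_
    rw [norm_iteratedFDeriv_zero]
    calc ‖f (φ x) - g (ψ x)‖ = ‖(f (φ x) - f (ψ x)) + (f (ψ x) - g (ψ x))‖ := by
          rw [sub_add_sub_cancel]
      _ ≤ _ := norm_add_le _ _
      _ ≤ _ := add_le_add ((lip0 _ _).trans (mul_le_mul_of_nonneg_left (d0 x) p1)) (h0 _)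
  have e1 : supDeriv 1 (fun x => f (φ x) - g (ψ x)) ≤
      supDeriv 1 f * supDeriv 1 (fun x => φ x - ψ x) +
      supDeriv 2 f * supDeriv 0 (fun x => φ x - ψ x) * (1 + supDeriv 1 (fun x => ψ x - x)) +
      supDeriv 1 (fun x => f x - g x) * (1 + supDeriv 1 (fun x => ψ x - x)) := by
    refine ciSup_le fun x => ?_
    rw [norm_iteratedFDeriv_one]
    have c1 : HasFDerivAt (fun x => f (φ x)) ((fderiv ℝ f (φ x)).comp (fderiv ℝ φ.toFun x)) x :=
      (fd (φ x)).hasFDerivAt.comp x (hφ x).hasFDerivAt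
    have c2 : HasFDerivAt (fun x => g (ψ x)) ((fderiv ℝ g (ψ x)).comp (fderiv ℝ ψ.toFun x)) x :=
      (gd (ψ x)).hasFDerivAt.comp x (hψ x).hasFDerivAt
    rw [(c1.fun_sub c2).fderiv]
    have e : (fderiv ℝ f (φ x)).comp (fderiv ℝ φ.toFun x) -
        (fderiv ℝ g (ψ x)).comp (fderiv ℝ ψ.toFun x) =
        (fderiv ℝ f (φ x)).comp (fderiv ℝ φ.toFun x - fderiv ℝ ψ.toFun x) +
        (fderiv ℝ f (φ x) - fderiv ℝ f (ψ x)).comp (fderiv ℝ ψ.toFun x) +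
        (fderiv ℝ f (ψ x) - fderiv ℝ g (ψ x)).comp (fderiv ℝ ψ.toFun x) := by
      simp only [ContinuousLinearMap.comp_sub, ContinuousLinearMap.sub_comp]
      abel
    rw [e]
    refine (norm_add₃_le).trans (add_le_add (add_le_add ?_ ?_) ?_)
    · exact (ContinuousLinearMap.opNorm_comp_le _ _).trans
        (mul_le_mul (f1 _) (d1 x) (norm_nonneg _) p1)
    · exact (ContinuousLinearMap.opNorm_comp_le _ _).trans
        (mul_le_mul ((lip1 _ _).trans (mul_le_mul_of_nonneg_left (d0 x) p2)) (n1 x)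
          (norm_nonneg _) (mul_nonneg p2 r0))
    · exact (ContinuousLinearMap.opNorm_comp_le _ _).trans
        (mul_le_mul (h1 _) (n1 x) (norm_nonneg _) q1)
  generalize supDeriv 0 (fun x => φ x - ψ x) = D0 at *
  generalize supDeriv 1 (fun x => φ x - ψ x) = D1 at *
  generalize supDeriv 0 (fun x => ψ x - x) = N0 at *
  generalize supDeriv 1 (fun x => ψ x - x) = N1 at *
  generalize supDeriv 0 (fun x => f x - g x) = H0 at *
  generalize supDeriv 1 (fun x => f x - g x) = H1 at *
  generalize supDeriv 2 (fun x => f x - g x) = H2 at *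
  generalize supDeriv 0 f = F0 at *
  generalize supDeriv 1 f = F1 at *
  generalize supDeriv 2 f = F2 at *
  calc _ ≤ _ := add_le_add e0 e1
    _ ≤ (2 + (N0 + N1)) * ((F1 + F2) * (D0 + D1) + (H0 + H1)) := by
      rw [← sub_nonneg]
      ring_nf
      positivity
    _ ≤ _ := by
      gcongr
      · linarith
      · linarith

lemma aux_vel {V : Type*} [NormedAddCommGroup V] [InnerProductSpace ℝ V]
    {B : V →L[ℝ] V →L[ℝ] ℝ} {ω : ℝ} (hω : 0 < ω) (hB : ∀ u, 0 ≤ B u u)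
    {j : V →L[ℝ] ℝ} {v : V} (h : IsVel B ω j v) : ‖v‖ ≤ ‖j‖ / ω := by
  rw [le_div_iff₀ hω]
  rcases (norm_nonneg v).eq_or_lt' with h0 | h0
  · rw [h0]; simp
  have h1 := h v
  rw [real_inner_self_eq_norm_sq] at h1
  have h2 := (le_abs_self _).trans (j.le_opNorm v)
  have h3 := hB v
  refine le_of_mul_le_mul_right ?_ h0
  nlinarith

lemma aux_vel_sub {V : Type*} [NormedAddCommGroup V] [InnerProductSpace ℝ V]
    {B C : V →L[ℝ] V →L[ℝ] ℝ} {ω : ℝ} (hω : 0 < ω) (hB : ∀ u, 0 ≤ B u u)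
    (hC : ∀ u, 0 ≤ C u u)
    {j : V →L[ℝ] ℝ} {u v : V} (hu : IsVel B ω j u) (hv : IsVel C ω j v) :
    ‖u - v‖ ≤ ‖B - C‖ * ‖j‖ / ω ^ 2 := by
  have key : IsVel B ω (-((B - C) v)) (u - v) := by
    intro w
    have h1 := hu w
    have h2 := hv w
    simp only [inner_sub_left, map_sub, ContinuousLinearMap.sub_apply,
      ContinuousLinearMap.neg_apply]
    linarith
  have h1 := aux_vel hω hB key
  rw [norm_neg] at h1
  have h2 := aux_vel hω hC hv
  calc _ ≤ _ := h1
    _ ≤ (‖B - C‖ * (‖j‖ / ω)) / ω := by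
      gcongr
      exact ((B - C).le_opNorm v).trans (by gcongr)
    _ = _ := by field_simp

/-- **Corollary 7.3 (Lipschitz estimate for `F(j,φ) = v_{φ,j} ∘ φ`).**
With `v_{φ,j} = (ω K_V⁻¹ + A_φ)⁻¹ j`,
`‖F(j,φ) − F(j,ψ)‖_{1,∞} ≤ (2 + ‖ψ − id‖_{1,∞}) ((c_V/ω)‖φ − ψ‖_{1,∞} +
(c_V/ω²)‖A_φ − A_ψ‖) ‖j‖`; in particular if `φ ↦ A_φ` is locally Lipschitz for
`‖·‖_{1,∞}`, then so is `φ ↦ F(j,φ)`. -/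
theorem velocity_composition_lipschitz
    {V : Type*} [NormedAddCommGroup V] [InnerProductSpace ℝ V] [CompleteSpace V]
    [TopologicalSpace.SeparableSpace V]
    (emb : V →ₗ[ℝ] (E3 → E3)) (cV : ℝ) (hcV : 0 < cV)
    (hembC0 : ∀ u : V, MemC0 2 (emb u))
    (hembBound : ∀ u : V, normS 2 (emb u) ≤ cV * ‖u‖)
    (ω : ℝ) (hω : 0 < ω)
    (A : DiffId 1 → V →L[ℝ] V →L[ℝ] ℝ)
    (hAsymm : ∀ (φ : DiffId 1) (u w : V), A φ u w = A φ w u)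
    (hApos : ∀ (φ : DiffId 1) (u : V), 0 ≤ A φ u u)
    (j : V →L[ℝ] ℝ) :
    (∀ (φ ψ : DiffId 1) (vφ vψ : V), IsVel (A φ) ω j vφ → IsVel (A ψ) ω j vψ →
      normS 1 (fun x => emb vφ (φ x) - emb vψ (ψ x)) ≤
        (2 + normS 1 fun x => ψ x - x) *
          (cV / ω * distS 1 φ ψ + cV / ω ^ 2 * ‖A φ - A ψ‖) * ‖j‖) ∧
    ((∀ φ₀ : DiffId 1, ∃ r > 0, ∃ ℓ > 0, ∀ φ ψ : DiffId 1,
        distS 1 φ φ₀ ≤ r → distS 1 ψ φ₀ ≤ r → ‖A φ - A ψ‖ ≤ ℓ * distS 1 φ ψ) →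
      ∀ φ₀ : DiffId 1, ∃ r > 0, ∃ ℓ > 0, ∀ φ ψ : DiffId 1,
        distS 1 φ φ₀ ≤ r → distS 1 ψ φ₀ ≤ r →
        ∀ vφ vψ : V, IsVel (A φ) ω j vφ → IsVel (A ψ) ω j vψ →
          normS 1 (fun x => emb vφ (φ x) - emb vψ (ψ x)) ≤ ℓ * distS 1 φ ψ) := by
  have main : ∀ (φ ψ : DiffId 1) (vφ vψ : V), IsVel (A φ) ω j vφ → IsVel (A ψ) ω j vψ →
      normS 1 (fun x => emb vφ (φ x) - emb vψ (ψ x)) ≤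
        (2 + normS 1 fun x => ψ x - x) *
          (cV / ω * distS 1 φ ψ + cV / ω ^ 2 * ‖A φ - A ψ‖) * ‖j‖ := by
    intro φ ψ u v hu hv
    have e : (fun x => emb u x - emb v x) = emb (u - v) := by
      rw [map_sub]; rfl
    have h1 : normS 2 (emb u) ≤ cV * (‖j‖ / ω) :=
      (hembBound u).trans (mul_le_mul_of_nonneg_left (aux_vel hω (hApos φ) hu) hcV.le)
    have h2 : normS 2 (fun x => emb u x - emb v x) ≤ cV * (‖A φ - A ψ‖ * ‖j‖ / ω ^ 2) := by
      rw [e]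
      exact (hembBound _).trans (mul_le_mul_of_nonneg_left
        (aux_vel_sub hω (hApos φ) (hApos ψ) hu hv) hcV.le)
    refine (aux_comp (hembC0 u) (hembC0 v) φ ψ h1 h2).trans (le_of_eq ?_)
    ring
  refine ⟨main, fun hA φ₀ => ?_⟩
  obtain ⟨r, hr, ℓ, hℓ, hL⟩ := hA φ₀
  have hN := aux_normS_nonneg 1 (fun x => φ₀ x - x)
  refine ⟨r, hr, (2 + (r + normS 1 (fun x => φ₀ x - x))) * (cV / ω + cV / ω ^ 2 * ℓ) * ‖j‖ + 1,
    by positivity, fun φ ψ h1 h2 u v hu hv => ?_⟩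
  have hd : 0 ≤ distS 1 φ ψ := aux_normS_nonneg _ _
  have hψ : normS 1 (fun x => ψ x - x) ≤ r + normS 1 (fun x => φ₀ x - x) := by
    have hneg : MemC0 1 (fun x => x - φ₀ x) := by
      have h0 : MemC0 1 (fun _ : E3 => (0 : E3)) := by
        have := aux_diff φ₀ φ₀
        simpa using this
      simpa using aux_sub h0 φ₀.memC0
    have heq : normS 1 (fun x => x - φ₀ x) = normS 1 (fun x => φ₀ x - x) := by
      have : (fun x => x - φ₀ x) = -(fun x => φ₀ x - x) := by
        ext1 x; simp
      rw [this]
      simp [normS, supDeriv, iteratedFDeriv_neg]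
    have := aux_tri (aux_diff ψ φ₀) hneg
    rw [heq] at this
    have e : (fun x => ψ x - φ₀ x - (x - φ₀ x)) = fun x => ψ x - x := by
      ext1 x; simp
    rw [e] at this
    exact this.trans (add_le_add h2 le_rfl)
  have hψ0 := aux_normS_nonneg 1 (fun x => ψ x - x)
  have hLL := hL φ ψ h1 h2
  calc _ ≤ _ := main φ ψ u v hu hv
    _ ≤ (2 + (r + normS 1 (fun x => φ₀ x - x))) *
        (cV / ω * distS 1 φ ψ + cV / ω ^ 2 * (ℓ * distS 1 φ ψ)) * ‖j‖ := by
      gcongr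
    _ ≤ _ := by nlinarith

end
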